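/- (Set-comparison monotonicity) For any damping factor α ∈ (0,1) and arguments x_i, x_j ∈ X: if there exists an injective map λ : R^-(x_i) → R^-(x_j) such that v_α(λ(x)) ≥ v_α(x) for every x ∈ R^-(x_i), then v_α(x_i) ≥ v_α(x_j). -/

import Mathlib

open Matrix Filter Topology

/-- Set-comparison monotonicity: if there is an injection λ from the
attackers of x_i to the attackers of x_j with v(λ(x)) ≥ v(x) for all attackers x of x_i,
then v(x_i) ≥ v(x_j). -/
theorem counting_semantics_set_monotone
    (n : ℕ) (R : Fin n → Fin n → Prop) [DecidableRel R]
    (hR : ∃ i j, R i j)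
    (A : Matrix (Fin n) (Fin n) ℝ)
    (hA : ∀ i j, A i j = if R j i then 1 else 0)
    (N : ℝ) (hN : IsGreatest (Set.range fun i : Fin n => ∑ j, |A i j|) N)
    (At : Matrix (Fin n) (Fin n) ℝ) (hAt : At = N⁻¹ • A)
    (e : Fin n → ℝ) (he : e = fun _ => 1)
    (α : ℝ) (hα : α ∈ Set.Ioo (0 : ℝ) 1)
    (vs : ℕ → Fin n → ℝ)
    (hvs : ∀ k, vs k = ∑ ℓ ∈ Finset.range (k + 1), ((-1 : ℝ) ^ ℓ * α ^ ℓ) • ((At ^ ℓ) *ᵥ e))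
    (v : Fin n → ℝ) (hv : Tendsto vs atTop (𝓝 v))
    (xi xj : Fin n)
    (lam : {y : Fin n // R y xi} → {y : Fin n // R y xj})
    (hinj : Function.Injective lam)
    (hmono : ∀ y, v y.1 ≤ v (lam y).1) :
    v xj ≤ v xi := by
  obtain ⟨hα0, hα1⟩ := hα
  have hA0 : ∀ i j, 0 ≤ A i j := by
    intro i j
    rw [hA]
    split_ifs <;> norm_num
  have hrow : ∀ i, ∑ j, A i j ≤ N := by
    intro i
    have h := hN.2 ⟨i, rfl⟩
    simpa only [abs_of_nonneg (hA0 i _)] using h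
  have hNpos : 0 < N := by
    obtain ⟨a, b, hab⟩ := hR
    have h1 : A b a ≤ ∑ j, A b j :=
      Finset.single_le_sum (fun j _ => hA0 b j) (Finset.mem_univ a)
    have h2 : A b a = 1 := by rw [hA, if_pos hab]
    linarith [hrow b]
  have hrec : ∀ k, vs (k + 1) = e - α • (At *ᵥ vs k) := by
    intro k
    rw [hvs (k + 1), Finset.sum_range_succ', hvs k, Matrix.mulVec_sum, Finset.smul_sum,
      sub_eq_add_neg, ← Finset.sum_neg_distrib, add_comm]
    congr 1
    · simp
    · refine Finset.sum_congr rfl fun l _ => ?_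
      rw [Matrix.mulVec_smul, Matrix.mulVec_mulVec, ← pow_succ', smul_smul, ← neg_smul]
      congr 1
      ring
  have hAtv : ∀ (w : Fin n → ℝ) i, (At *ᵥ w) i = N⁻¹ * ∑ j, A i j * w j := by
    intro w i
    rw [hAt, Matrix.smul_mulVec]
    simp [Matrix.mulVec, dotProduct]
  have hbd : ∀ k i, 0 ≤ vs k i ∧ vs k i ≤ 1 := by
    intro k
    induction k with
    | zero => intro i; rw [hvs]; simp [he]
    | succ k ih =>
      intro i
      have h0 : 0 ≤ ∑ j, A i j * vs k j :=
        Finset.sum_nonneg fun j _ => mul_nonneg (hA0 i j) (ih j).1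
      have h1 : ∑ j, A i j * vs k j ≤ N :=
        (Finset.sum_le_sum fun j _ => mul_le_of_le_one_right (hA0 i j) (ih j).2).trans (hrow i)
      have h2 : 0 ≤ N⁻¹ * ∑ j, A i j * vs k j := mul_nonneg (by positivity) h0
      have h3 : N⁻¹ * ∑ j, A i j * vs k j ≤ 1 := by
        rw [inv_mul_le_iff₀ hNpos]; linarith
      have h4 : vs (k + 1) i = 1 - α * (N⁻¹ * ∑ j, A i j * vs k j) := by
        rw [hrec, Pi.sub_apply, Pi.smul_apply, hAtv, he, smul_eq_mul]
      rw [h4]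
      constructor <;> nlinarith
  have hvi : ∀ i, Tendsto (fun k => vs k i) atTop (𝓝 (v i)) := tendsto_pi_nhds.1 hv
  have hv0 : ∀ i, 0 ≤ v i := fun i => ge_of_tendsto' (hvi i) fun k => (hbd k i).1
  have hfix : ∀ i, v i = 1 - α * (N⁻¹ * ∑ j, A i j * v j) := by
    intro i
    have h1 : Tendsto (fun k => vs (k + 1) i) atTop (𝓝 (v i)) :=
      (hvi i).comp (tendsto_add_atTop_nat 1)
    have h2 : Tendsto (fun k => 1 - α * (N⁻¹ * ∑ j, A i j * vs k j)) atTop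
        (𝓝 (1 - α * (N⁻¹ * ∑ j, A i j * v j))) :=
      tendsto_const_nhds.sub (((tendsto_finsetSum _ fun j _ =>
        (hvi j).const_mul (A i j)).const_mul _).const_mul _)
    refine tendsto_nhds_unique h1 (h2.congr fun k => ?_)
    rw [hrec, Pi.sub_apply, Pi.smul_apply, hAtv, he, smul_eq_mul]
  have hsum : ∀ i, ∑ j, A i j * v j = ∑ y : {y : Fin n // R y i}, v y.1 := by
    intro i
    rw [← Finset.sum_subtype (Finset.univ.filter fun y => R y i) (by simp) v, Finset.sum_filter]
    exact Finset.sum_congr rfl fun j _ => by rw [hA]; split_ifs <;> simp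
  have key : ∑ j, A xi j * v j ≤ ∑ j, A xj j * v j := by
    rw [hsum, hsum]
    calc ∑ y : {y : Fin n // R y xi}, v y.1 ≤ ∑ y, v (lam y).1 :=
          Finset.sum_le_sum fun y _ => hmono y
      _ = ∑ z ∈ Finset.univ.image lam, v z.1 := by
          rw [Finset.sum_image fun a _ b _ h => hinj h]
      _ ≤ ∑ z : {y : Fin n // R y xj}, v z.1 :=
          Finset.sum_le_sum_of_subset_of_nonneg (Finset.subset_univ _) fun z _ _ => hv0 z.1
  rw [hfix xi, hfix xj]
  gcongr
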